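/- arXiv:2402.05385 — 2 statements merged into one kernel-verified Lean document; each statement's English description precedes it below -/
import Mathlib

section
/- Let u, v be independent uniform on S^{n-1}, let G ∈ R^{n×n} be a fixed symmetric matrix of rank at most 2r with eigenvalues λ_1,...,λ_{2r}, and let B = n² u u^T G v v^T. Then for every integer p ≥ 1, E[(B^T B)^p] ⪯ ((2p)!/2)·‖G‖^{2p}·(C n r)^{2p-1}·I_n for some absolute constant C, where ‖G‖ is the operator norm of G. -/
open MeasureTheory Matrix

/-- `μ` is the uniform distribution on the unit sphere `S^{n-1} ⊂ ℝ^n`. -/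
def IsUniformOnSphere {n : ℕ} (μ : Measure (EuclideanSpace ℝ (Fin n))) : Prop :=
  IsProbabilityMeasure μ ∧
  μ (Metric.sphere (0 : EuclideanSpace ℝ (Fin n)) 1) = 1 ∧
  ∀ Q : EuclideanSpace ℝ (Fin n) ≃ₗᵢ[ℝ] EuclideanSpace ℝ (Fin n),
    Measure.map Q μ = μ

/-- The ℓ²→ℓ² operator norm of a real matrix. -/
noncomputable def opNorm {n : ℕ} (A : Matrix (Fin n) (Fin n) ℝ) : ℝ :=
  ‖Matrix.toEuclideanCLM (𝕜 := ℝ) A‖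

/-- The random matrix `B = n² u uᵀ G v vᵀ` for `(u, v)` a pair of spherical vectors. -/
noncomputable def Bmat {n : ℕ} (G : Matrix (Fin n) (Fin n) ℝ)
    (q : EuclideanSpace ℝ (Fin n) × EuclideanSpace ℝ (Fin n)) :
    Matrix (Fin n) (Fin n) ℝ :=
  (n : ℝ) ^ 2 • (Matrix.vecMulVec (fun a => q.1 a) (fun a => q.1 a) * G *
    Matrix.vecMulVec (fun a => q.2 a) (fun a => q.2 a))


namespace SphereAux

variable {n : ℕ} {μ : Measure (EuclideanSpace ℝ (Fin n))}

lemma ae_norm (h : IsUniformOnSphere μ) : ∀ᵐ u ∂μ, ‖u‖ = 1 := by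
  obtain ⟨hp, hs, -⟩ := h
  have := (prob_compl_eq_zero_iff (μ := μ) Metric.isClosed_sphere.measurableSet).2 hs
  have h2 : ∀ᵐ u ∂μ, u ∈ Metric.sphere (0 : EuclideanSpace ℝ (Fin n)) 1 := this
  filter_upwards [h2] with u hu
  simpa using hu

lemma ae_prod_norm (h : IsUniformOnSphere μ) : ∀ᵐ q ∂(μ.prod μ), ‖q.1‖ = 1 ∧ ‖q.2‖ = 1 := by
  have := h.1
  have h1 := (Measure.quasiMeasurePreserving_fst (μ := μ) (ν := μ)).ae (ae_norm h)
  have h2 := (Measure.quasiMeasurePreserving_snd (μ := μ) (ν := μ)).ae (ae_norm h)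
  filter_upwards [h1, h2] with q a b using ⟨a, b⟩

lemma integrable_cont (h : IsUniformOnSphere μ) {f : EuclideanSpace ℝ (Fin n) → ℝ}
    (hf : Continuous f) : Integrable f μ := by
  have := h.1
  have h2 : ∀ᵐ u ∂μ, u ∈ Metric.sphere (0 : EuclideanSpace ℝ (Fin n)) 1 := by
    filter_upwards [ae_norm h] with u hu
    simpa using hu
  rw [← Measure.restrict_eq_self_of_ae_mem h2]
  exact hf.continuousOn.integrableOn_compact (isCompact_sphere _ _)

lemma integrable_cont_prod (h : IsUniformOnSphere μ)
    {f : EuclideanSpace ℝ (Fin n) × EuclideanSpace ℝ (Fin n) → ℝ}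
    (hf : Continuous f) : Integrable f (μ.prod μ) := by
  have := h.1
  have h2 : ∀ᵐ q ∂(μ.prod μ), q ∈ (Metric.sphere (0 : EuclideanSpace ℝ (Fin n)) 1) ×ˢ
      (Metric.sphere (0 : EuclideanSpace ℝ (Fin n)) 1) := by
    filter_upwards [ae_prod_norm h] with q hq
    simpa using hq
  rw [← Measure.restrict_eq_self_of_ae_mem h2]
  exact hf.continuousOn.integrableOn_compact ((isCompact_sphere _ _).prod (isCompact_sphere _ _))

lemma moment_norm (h : IsUniformOnSphere μ) (a b : EuclideanSpace ℝ (Fin n)) (hab : ‖a‖ = ‖b‖)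
    (m : ℕ) : ∫ u, (inner ℝ u a) ^ m ∂μ = ∫ u, (inner ℝ u b) ^ m ∂μ := by
  let Q := (ℝ ∙ (a - b))ᗮ.reflection
  have hQ : Q a = b := Submodule.reflection_sub hab
  have hm := h.2.2 Q
  conv_rhs => rw [← hm]
  rw [integral_map (by fun_prop) (by fun_prop)]
  refine integral_congr_ae (.of_forall fun u => ?_)
  simp only [← hQ, LinearIsometryEquiv.inner_map_map]

lemma moment_hom (h : IsUniformOnSphere μ) (a b : EuclideanSpace ℝ (Fin n)) (m : ℕ) :
    ‖a‖ ^ m * ∫ u, (inner ℝ u b) ^ m ∂μ = ‖b‖ ^ m * ∫ u, (inner ℝ u a) ^ m ∂μ := by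
  have := moment_norm h (‖a‖ • b) (‖b‖ • a) (by simp [norm_smul, mul_comm]) m
  simpa only [inner_smul_right, mul_pow, integral_const_mul] using this

/-- random sign vectors -/
noncomputable def sv (e : Fin n → Bool) : EuclideanSpace ℝ (Fin n) :=
  WithLp.toLp 2 (fun i => if e i then (1 : ℝ) else -1)

lemma norm_sv (e : Fin n → Bool) : ‖sv e‖ ^ 2 = n := by
  rw [EuclideanSpace.norm_sq_eq]
  have : ∀ i, ‖(sv e) i‖ ^ 2 = 1 := by
    intro i
    simp only [sv]
    split_ifs <;> simp
  rw [Finset.sum_congr rfl (fun i _ => this i)]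
  simp

lemma sum_exp (y : EuclideanSpace ℝ (Fin n)) :
    ∑ e : Fin n → Bool, Real.exp (inner ℝ y (sv e)) ≤ 2 ^ n * Real.exp (‖y‖ ^ 2 / 2) := by
  have h1 : ∀ e : Fin n → Bool, Real.exp (inner ℝ y (sv e)) =
      ∏ i, Real.exp (if e i then y i else - y i) := by
    intro e
    rw [← Real.exp_sum]
    congr 1
    rw [PiLp.inner_apply]
    refine Finset.sum_congr rfl fun i _ => ?_
    simp only [sv]
    split_ifs <;> simp
  simp only [h1]
  rw [← Fintype.prod_sum (fun (i : Fin n) (b : Bool) => Real.exp (if b then y i else - y i))]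
  have h2 : ∀ i, ∑ b : Bool, Real.exp (if b then y i else - y i) = 2 * Real.cosh (y i) := by
    intro i
    simp [Real.cosh_eq]
    ring
  simp only [h2]
  calc ∏ i, 2 * Real.cosh (y i) ≤ ∏ i, 2 * Real.exp (y i ^ 2 / 2) := by
        refine Finset.prod_le_prod (fun i _ => by positivity) fun i _ => ?_
        have := Real.cosh_le_exp_half_sq (y i)
        linarith
    _ = _ := by
        rw [Finset.prod_mul_distrib, ← Real.exp_sum, EuclideanSpace.norm_sq_eq, ← Finset.sum_div]
        simp

lemma pow_le_cosh (x : ℝ) (p : ℕ) : x ^ (2 * p) ≤ (2 * p).factorial * Real.cosh x := by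
  have h := le_hasSum (Real.hasSum_cosh x) p (fun j _ => by
    have : 0 ≤ x ^ (2 * j) := by rw [pow_mul]; positivity
    positivity)
  rw [div_le_iff₀ (by positivity)] at h
  linarith

lemma sum_pow_sv (y : EuclideanSpace ℝ (Fin n)) (p : ℕ) :
    ∑ e : Fin n → Bool, (inner ℝ y (sv e)) ^ (2 * p) ≤
      (2 * p).factorial * (2 ^ n * Real.exp (‖y‖ ^ 2 / 2)) := by
  have h1 := sum_exp y
  have h2 := sum_exp (-y)
  simp only [inner_neg_left, norm_neg] at h2
  calc _ ≤ ∑ e : Fin n → Bool, (2 * p).factorial * Real.cosh (inner ℝ y (sv e)) :=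
        Finset.sum_le_sum fun e _ => pow_le_cosh _ _
    _ = (2 * p).factorial * ((∑ e : Fin n → Bool, Real.exp (inner ℝ y (sv e)) +
          ∑ e : Fin n → Bool, Real.exp (- inner ℝ y (sv e))) / 2) := by
        rw [← Finset.mul_sum, ← Finset.sum_add_distrib, Finset.sum_div]
        simp only [Real.cosh_eq]
    _ ≤ _ := by
        gcongr
        linarith

lemma moment_bound (h : IsUniformOnSphere μ) (w : EuclideanSpace ℝ (Fin n)) (p : ℕ) {s : ℝ}
    (hs : 0 < s) : (s * n) ^ p * ∫ u, (inner ℝ u w) ^ (2 * p) ∂μ ≤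
      ‖w‖ ^ (2 * p) * ((2 * p).factorial * Real.exp (s / 2)) := by
  have := h.1
  have h1 : ∀ e : Fin n → Bool, (n : ℝ) ^ p * ∫ u, (inner ℝ u w) ^ (2 * p) ∂μ =
      ‖w‖ ^ (2 * p) * ∫ u, (inner ℝ u (sv e)) ^ (2 * p) ∂μ := by
    intro e
    rw [← moment_hom h, pow_mul ‖sv e‖, norm_sv]
  have h2 : (2 : ℝ) ^ n * ((n : ℝ) ^ p * ∫ u, (inner ℝ u w) ^ (2 * p) ∂μ) =
      ‖w‖ ^ (2 * p) * ∫ u, ∑ e : Fin n → Bool, (inner ℝ u (sv e)) ^ (2 * p) ∂μ := by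
    rw [integral_finsetSum _ (fun e _ => integrable_cont h (by fun_prop)), Finset.mul_sum,
      ← Finset.sum_congr rfl (fun e _ => h1 e)]
    simp
  have h3 : s ^ p * ∫ u, ∑ e : Fin n → Bool, (inner ℝ u (sv e)) ^ (2 * p) ∂μ ≤
      (2 * p).factorial * (2 ^ n * Real.exp (s / 2)) := by
    rw [← integral_const_mul]
    calc _ ≤ ∫ u, ((2 * p).factorial * (2 ^ n * Real.exp (s / 2)) : ℝ) ∂μ := by
          refine integral_mono_ae (integrable_cont h (by fun_prop)) (integrable_const _) ?_
          filter_upwards [ae_norm h] with u hu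
          have := sum_pow_sv (√s • u) p
          rw [norm_smul, hu, mul_one, Real.norm_eq_abs, sq_abs, Real.sq_sqrt hs.le] at this
          simp only [inner_smul_left, mul_pow, ← Finset.mul_sum] at this
          rw [pow_mul] at this
          simpa [Real.sq_sqrt hs.le] using this
      _ = _ := by simp
  have h4 : (0 : ℝ) < 2 ^ n := by positivity
  refine le_of_mul_le_mul_left ?_ h4
  calc _ = s ^ p * ((2 : ℝ) ^ n * ((n : ℝ) ^ p * ∫ u, (inner ℝ u w) ^ (2 * p) ∂μ)) := by ring
    _ = ‖w‖ ^ (2 * p) * (s ^ p * ∫ u, ∑ e : Fin n → Bool, (inner ℝ u (sv e)) ^ (2 * p) ∂μ) := by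
        rw [h2]; ring
    _ ≤ ‖w‖ ^ (2 * p) * ((2 * p).factorial * (2 ^ n * Real.exp (s / 2))) := by
        gcongr
    _ = _ := by ring


lemma norm_T_bound (G : Matrix (Fin n) (Fin n) ℝ) (hG : G.IsHermitian) (r : ℕ)
    (hr : G.rank ≤ 2 * r) : ∃ (k : ℕ) (e : Fin k → EuclideanSpace ℝ (Fin n)), k ≤ 2 * r ∧
      (∀ i, ‖e i‖ = 1) ∧ ∀ v, ‖toEuclideanCLM (𝕜 := ℝ) G v‖ ^ 2 ≤
        opNorm G ^ 2 * ∑ i, (inner ℝ v (e i)) ^ 2 := by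
  set T := toEuclideanCLM (𝕜 := ℝ) G with hT
  let T' : EuclideanSpace ℝ (Fin n) →ₗ[ℝ] EuclideanSpace ℝ (Fin n) := T
  have hsym : T'.IsSymmetric := by
    have : T' = toEuclideanLin G := by
      ext x; simp [T', hT, toEuclideanLin]
    rw [this]
    exact Matrix.isSymmetric_toEuclideanLin_iff.2 hG
  have hker := hsym.orthogonal_range
  have hfr : Module.finrank ℝ T'.range = G.rank := by
    rw [Matrix.rank_eq_finrank_range_toLin G (EuclideanSpace.basisFun (Fin n) ℝ).toBasis
      (EuclideanSpace.basisFun (Fin n) ℝ).toBasis]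
    have : T' = toLin (EuclideanSpace.basisFun (Fin n) ℝ).toBasis
        (EuclideanSpace.basisFun (Fin n) ℝ).toBasis G := by
      rw [← Matrix.toEuclideanLin_eq_toLin_orthonormal]
      ext x; simp [T', hT, toEuclideanLin]
    rw [this]
  let b := stdOrthonormalBasis ℝ T'.range
  refine ⟨_, fun i => (b i : EuclideanSpace ℝ (Fin n)), by rw [hfr]; exact hr, ?_, ?_⟩
  · intro i
    exact b.orthonormal.1 i
  · intro v
    let P := T'.range.orthogonalProjectionOnto v
    have h1 : T v = T (P : EuclideanSpace ℝ (Fin n)) := by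
      have : v - P ∈ T'.ker := by
        rw [← hker]
        exact Submodule.sub_starProjection_mem_orthogonal v
      have h0 : T (v - P) = 0 := this
      rw [map_sub, sub_eq_zero] at h0
      exact h0
    have h2 : ∑ i, (inner ℝ v (b i : EuclideanSpace ℝ (Fin n))) ^ 2 = ‖P‖ ^ 2 := by
      rw [← b.sum_sq_norm_inner_right P]
      refine Finset.sum_congr rfl fun i _ => ?_
      rw [Real.norm_eq_abs, sq_abs, real_inner_comm P (b i)]
      congr 1
      exact (Submodule.inner_orthogonalProjectionOnto_eq_of_mem_right (b i) v).symm
    rw [h2, h1, ← mul_pow]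
    gcongr
    exact T.le_opNorm _

lemma Bpow (G : Matrix (Fin n) (Fin n) ℝ)
    (q : EuclideanSpace ℝ (Fin n) × EuclideanSpace ℝ (Fin n)) (h1 : ‖q.1‖ = 1) (h2 : ‖q.2‖ = 1)
    (p : ℕ) (hp : 1 ≤ p) (i j : Fin n) : (((Bmat G q)ᵀ * Bmat G q) ^ p) i j =
      (n : ℝ) ^ (4 * p) * (inner ℝ q.1 (toEuclideanCLM (𝕜 := ℝ) G q.2)) ^ (2 * p) *
        (q.2 i * q.2 j) := by
  obtain ⟨u, v⟩ := q
  simp only at h1 h2 ⊢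
  set a := inner ℝ u (toEuclideanCLM (𝕜 := ℝ) G v) with ha
  have ha' : (fun i => u i) ᵥ* G ⬝ᵥ (fun i => v i) = a := by
    rw [← Matrix.dotProduct_mulVec, ha, PiLp.inner_apply]
    simp [dotProduct, Matrix.ofLp_toEuclideanCLM, mul_comm]
  have hu : (fun i => u i) ⬝ᵥ (fun i => u i) = 1 := by
    have := EuclideanSpace.norm_sq_eq u
    rw [h1] at this
    simp only [Real.norm_eq_abs, sq_abs] at this
    simp only [dotProduct, ← pow_two, ← this]; norm_num
  have hv : (fun i => v i) ⬝ᵥ (fun i => v i) = 1 := by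
    have := EuclideanSpace.norm_sq_eq v
    rw [h2] at this
    simp only [Real.norm_eq_abs, sq_abs] at this
    simp only [dotProduct, ← pow_two, ← this]; norm_num
  have hB : Bmat G (u, v) = ((n : ℝ) ^ 2 * a) • vecMulVec (fun i => u i) (fun i => v i) := by
    simp only [Bmat]
    rw [vecMulVec_mul, vecMulVec_mul_vecMulVec, ha', vecMulVec_smul, smul_smul]
  have hBB : (Bmat G (u, v))ᵀ * Bmat G (u, v) =
      ((n : ℝ) ^ 4 * a ^ 2) • vecMulVec (fun i => v i) (fun i => v i) := by
    rw [hB, transpose_smul, transpose_vecMulVec, Matrix.smul_mul, Matrix.mul_smul,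
      vecMulVec_mul_vecMulVec, hu, one_smul, smul_smul]
    congr 1
    ring
  have hV : ∀ m : ℕ, (vecMulVec (fun i => v i) (fun i => v i) : Matrix (Fin n) (Fin n) ℝ) ^ (m + 1) =
      vecMulVec (fun i => v i) (fun i => v i) := by
    intro m
    induction m with
    | zero => simp
    | succ m ih => rw [pow_succ, ih, vecMulVec_mul_vecMulVec, hv, one_smul]
  obtain ⟨m, rfl⟩ : ∃ m, p = m + 1 := ⟨p - 1, by omega⟩
  rw [hBB, smul_pow, hV, Matrix.smul_apply, vecMulVec_apply, smul_eq_mul, mul_pow, ← pow_mul,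
    ← pow_mul]

/-- Mixed moment. -/
lemma mixed (h : IsUniformOnSphere μ) (e x : EuclideanSpace ℝ (Fin n)) (he : ‖e‖ = 1)
    (hx : ‖x‖ = 1) (p : ℕ) {s : ℝ} (hs : 0 < s) :
    (s * n) ^ (p + 1) * ∫ v, (inner ℝ v e) ^ (2 * p) * (inner ℝ v x) ^ 2 ∂μ ≤
      2 * ((2 * (p + 1)).factorial * Real.exp (s / 2)) := by
  have h1 := moment_bound h e (p + 1) hs
  have h2 := moment_bound h x (p + 1) hs
  rw [he, one_pow, one_mul] at h1
  rw [hx, one_pow, one_mul] at h2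
  have h3 : ∫ v, (inner ℝ v e) ^ (2 * p) * (inner ℝ v x) ^ 2 ∂μ ≤
      ∫ v, (inner ℝ v e) ^ (2 * (p + 1)) ∂μ + ∫ v, (inner ℝ v x) ^ (2 * (p + 1)) ∂μ := by
    rw [← integral_add (integrable_cont h (by fun_prop)) (integrable_cont h (by fun_prop))]
    refine integral_mono (integrable_cont h (by fun_prop)) (integrable_cont h (by fun_prop)) ?_
    intro v
    simp only [pow_mul]
    generalize ha : (inner ℝ v e) ^ 2 = a
    generalize hb : (inner ℝ v x) ^ 2 = b
    have ha0 : 0 ≤ a := by rw [← ha]; positivity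
    have hb0 : 0 ≤ b := by rw [← hb]; positivity
    rcases le_total a b with hab | hab
    · have : a ^ p * b ≤ b ^ p * b := by gcongr
      have h5 : 0 ≤ a ^ (p + 1) := by positivity
      rw [pow_succ b]; linarith
    · have : a ^ p * b ≤ a ^ p * a := by gcongr
      have h5 : 0 ≤ b ^ (p + 1) := by positivity
      rw [pow_succ a]; linarith
  calc _ ≤ (s * n) ^ (p + 1) * (∫ v, (inner ℝ v e) ^ (2 * (p + 1)) ∂μ +
        ∫ v, (inner ℝ v x) ^ (2 * (p + 1)) ∂μ) := by gcongr
    _ ≤ _ := by rw [mul_add]; linarith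

lemma double (h : IsUniformOnSphere μ) (G : Matrix (Fin n) (Fin n) ℝ) (hG : G.IsHermitian) (r : ℕ)
    (hr : G.rank ≤ 2 * r) (x : EuclideanSpace ℝ (Fin n)) (hx : ‖x‖ = 1) (p : ℕ) (hp : 1 ≤ p)
    {s : ℝ} (hs : 0 < s) :
    (s * n) ^ (p + 1) * ((s * n) ^ p * ∫ q, (inner ℝ q.1 (toEuclideanCLM (𝕜 := ℝ) G q.2)) ^ (2 * p) *
        (inner ℝ q.2 x) ^ 2 ∂(μ.prod μ)) ≤
      ((2 * p).factorial * Real.exp (s / 2)) * opNorm G ^ (2 * p) * (2 * r) ^ p *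
       (2 * ((2 * (p + 1)).factorial * Real.exp (s / 2))) := by
  have := h.1
  obtain ⟨k, e, hk, he, hT⟩ := norm_T_bound G hG r hr
  set T := toEuclideanCLM (𝕜 := ℝ) G
  obtain ⟨m, rfl⟩ : ∃ m, p = m + 1 := ⟨p - 1, by omega⟩
  set p := m + 1 with hpm
  have hTp : ∀ v, ‖T v‖ ^ (2 * p) ≤
      opNorm G ^ (2 * p) * ((k : ℝ) ^ m * ∑ i, (inner ℝ v (e i)) ^ (2 * p)) := by
    intro v
    calc ‖T v‖ ^ (2 * p) = (‖T v‖ ^ 2) ^ p := by rw [pow_mul]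
      _ ≤ (opNorm G ^ 2 * ∑ i, (inner ℝ v (e i)) ^ 2) ^ p := by
          gcongr
          exact hT v
      _ = opNorm G ^ (2 * p) * (∑ i, (inner ℝ v (e i)) ^ 2) ^ p := by
          rw [mul_pow, pow_mul]
      _ ≤ _ := by
          have := pow_sum_le_card_mul_sum_pow (s := Finset.univ)
            (f := fun i => (inner ℝ v (e i)) ^ 2) (fun i _ => by positivity) m
          simp only [Finset.card_univ, Fintype.card_fin, ← pow_mul, ← hpm] at this
          have h0 : 0 ≤ opNorm G ^ (2 * p) := by rw [pow_mul]; positivity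
          exact mul_le_mul_of_nonneg_left this h0
  set K : ℝ := (2 * p).factorial * Real.exp (s / 2) with hK
  have hK0 : 0 ≤ K := by positivity
  have hN0 : 0 ≤ opNorm G := norm_nonneg _
  have step1 : (s * n) ^ p * ∫ q, (inner ℝ q.1 (T q.2)) ^ (2 * p) *
        (inner ℝ q.2 x) ^ 2 ∂(μ.prod μ) ≤
      K * opNorm G ^ (2 * p) * k ^ m *
        ∑ i, ∫ v, (inner ℝ v (e i)) ^ (2 * p) * (inner ℝ v x) ^ 2 ∂μ := by
    rw [integral_prod_symm _ (integrable_cont_prod h (by fun_prop)),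
      ← integral_finsetSum _ (fun e _ => integrable_cont h (by fun_prop)), ← integral_const_mul,
      ← integral_const_mul]
    have hint := (integrable_cont_prod h (f := fun q => (inner ℝ q.1 (T q.2)) ^ (2 * p) *
        (inner ℝ q.2 x) ^ 2) (by fun_prop)).integral_prod_right
    refine integral_mono (hint.const_mul _) (integrable_cont h (by fun_prop)) ?_
    intro v
    simp only
    rw [integral_mul_const, ← mul_assoc, ← Finset.sum_mul, ← mul_assoc]
    refine mul_le_mul_of_nonneg_right ?_ (sq_nonneg _)
    calc _ ≤ ‖T v‖ ^ (2 * p) * K := moment_bound h (T v) p hs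
      _ ≤ (opNorm G ^ (2 * p) * ((k : ℝ) ^ m * ∑ i, (inner ℝ v (e i)) ^ (2 * p))) * K := by
          gcongr; exact hTp v
      _ = _ := by ring
  calc _ ≤ (s * n) ^ (p + 1) * (K * opNorm G ^ (2 * p) * k ^ m *
        ∑ i, ∫ v, (inner ℝ v (e i)) ^ (2 * p) * (inner ℝ v x) ^ 2 ∂μ) := by gcongr
    _ = K * opNorm G ^ (2 * p) * k ^ m *
        ∑ i, (s * n) ^ (p + 1) * ∫ v, (inner ℝ v (e i)) ^ (2 * p) * (inner ℝ v x) ^ 2 ∂μ := by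
        rw [← Finset.mul_sum]; ring
    _ ≤ K * opNorm G ^ (2 * p) * k ^ m *
        ∑ i : Fin k, (2 * ((2 * (p + 1)).factorial * Real.exp (s / 2))) := by
        refine mul_le_mul_of_nonneg_left (Finset.sum_le_sum fun i _ => ?_) (by positivity)
        exact mixed h _ x (he i) hx p hs
    _ = K * opNorm G ^ (2 * p) * (k : ℝ) ^ p *
          (2 * ((2 * (p + 1)).factorial * Real.exp (s / 2))) := by
        simp [hpm]; ring
    _ ≤ _ := by
        have : (k : ℝ) ≤ 2 * r := by exact_mod_cast hk
        gcongr

lemma arith1 (p : ℕ) (hp : 1 ≤ p) (r : ℕ) :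
    (8 * (2 * p + 1) : ℝ) * (Real.exp p * Real.exp p) * (2 * r) ^ p ≤ (1000 * r) ^ (2 * p - 1) := by
  obtain ⟨m, rfl⟩ : ∃ m, p = m + 1 := ⟨p - 1, by omega⟩
  have h1 : Real.exp ((m + 1 : ℕ) : ℝ) * Real.exp ((m + 1 : ℕ) : ℝ) ≤ 9 ^ (m + 1) := by
    have : Real.exp ((m + 1 : ℕ) : ℝ) ≤ 3 ^ (m + 1) := by
      rw [← Real.exp_one_pow]
      gcongr
      exact Real.exp_one_lt_three.le
    calc _ ≤ (3 : ℝ) ^ (m + 1) * 3 ^ (m + 1) := by gcongr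
      _ = _ := by rw [← mul_pow]; norm_num
  have h2 : (2 * ((m + 1 : ℕ) : ℝ) + 1) ≤ 3 * 3 ^ m := by
    have := one_add_mul_le_pow (a := (2 : ℝ)) (by norm_num) m
    norm_num at this
    push_cast
    linarith
  have h3 : (r : ℝ) ^ (m + 1) ≤ r ^ (2 * m + 1) := by
    rcases Nat.eq_zero_or_pos r with rfl | hr
    · simp
    · exact pow_le_pow_right₀ (by exact_mod_cast hr) (by omega)
  have h4 : 2 * (m + 1) - 1 = 2 * m + 1 := by omega
  rw [h4, mul_pow, mul_pow]
  calc _ ≤ 8 * (3 * 3 ^ m) * 9 ^ (m + 1) * (2 ^ (m + 1) * (r : ℝ) ^ (2 * m + 1)) := by gcongr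
    _ = 432 * (54 : ℝ) ^ m * r ^ (2 * m + 1) := by
        rw [show (54 : ℝ) = 3 * 9 * 2 by norm_num, mul_pow, mul_pow]; ring
    _ ≤ 1000 * 1000000 ^ m * r ^ (2 * m + 1) := by gcongr <;> norm_num
    _ = _ := by
        rw [pow_succ (1000 : ℝ), pow_mul (1000 : ℝ), show (1000 : ℝ) ^ 2 = 1000000 by norm_num]; ring

lemma final_unit (h : IsUniformOnSphere μ) (G : Matrix (Fin n) (Fin n) ℝ) (hG : G.IsHermitian)
    (r : ℕ) (hr : G.rank ≤ 2 * r) (x : EuclideanSpace ℝ (Fin n)) (hx : ‖x‖ = 1) (p : ℕ)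
    (hp : 1 ≤ p) :
    (n : ℝ) ^ (4 * p) * ∫ q, (inner ℝ q.1 (toEuclideanCLM (𝕜 := ℝ) G q.2)) ^ (2 * p) *
        (inner ℝ q.2 x) ^ 2 ∂(μ.prod μ) ≤
      (((2 * p).factorial : ℝ) / 2) * opNorm G ^ (2 * p) * (1000 * n * r) ^ (2 * p - 1) := by
  have hs : (0 : ℝ) < 2 * p := by positivity
  have hN0 : 0 ≤ opNorm G := norm_nonneg _
  have hd := double h G hG r hr x hx p hp hs
  rw [show (2 * (p : ℝ) / 2) = p by ring] at hd
  set J := ∫ q, (inner ℝ q.1 (toEuclideanCLM (𝕜 := ℝ) G q.2)) ^ (2 * p) *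
        (inner ℝ q.2 x) ^ 2 ∂(μ.prod μ)
  have hf : ((2 * (p + 1)).factorial : ℝ) ≤ (2 * p + 2) * (2 * p + 1) * (2 * p) ^ (2 * p) := by
    have : (2 * (p + 1)).factorial = (2 * p + 2) * ((2 * p + 1) * (2 * p).factorial) := by
      rw [show 2 * (p + 1) = 2 * p + 1 + 1 by ring, Nat.factorial_succ, Nat.factorial_succ]
    rw [this]
    have h2 : ((2 * p).factorial : ℝ) ≤ (2 * p) ^ (2 * p) := by
      exact_mod_cast Nat.factorial_le_pow (2 * p)
    push_cast
    rw [mul_assoc]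
    gcongr
  have hf2 : ((2 * (p + 1)).factorial : ℝ) ≤ 2 * (2 * p + 1) * (2 * p) ^ (2 * p + 1) := by
    have hp1 : (1 : ℝ) ≤ p := by exact_mod_cast hp
    calc _ ≤ _ := hf
      _ ≤ (2 * (2 * p)) * (2 * p + 1) * (2 * p : ℝ) ^ (2 * p) := by gcongr; linarith
      _ = _ := by ring
  have h5 : (n : ℝ) ^ (2 * p + 1) * J ≤ (2 * p).factorial * opNorm G ^ (2 * p) *
      (4 * (2 * p + 1) * (Real.exp p * Real.exp p) * (2 * r) ^ p) := by
    have h4 : (0 : ℝ) < (2 * p) ^ (2 * p + 1) := by positivity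
    refine le_of_mul_le_mul_left ?_ h4
    calc _ = (2 * (p : ℝ) * n) ^ (p + 1) * ((2 * p * n) ^ p * J) := by
          rw [← mul_assoc, ← mul_assoc, ← mul_pow, ← pow_add]; congr 2; ring
      _ ≤ _ := hd
      _ ≤ (2 * p).factorial * Real.exp p * opNorm G ^ (2 * p) * (2 * r) ^ p *
          (2 * ((2 * (2 * p + 1) * (2 * p) ^ (2 * p + 1)) * Real.exp p)) := by gcongr
      _ = _ := by ring
  have h6 := arith1 p hp r
  calc _ = (n : ℝ) ^ (2 * p - 1) * ((n : ℝ) ^ (2 * p + 1) * J) := by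
        rw [← mul_assoc, ← pow_add]; congr 2; omega
    _ ≤ (n : ℝ) ^ (2 * p - 1) * ((2 * p).factorial * opNorm G ^ (2 * p) *
      (4 * (2 * p + 1) * (Real.exp p * Real.exp p) * (2 * r) ^ p)) := by gcongr
    _ = (2 * p).factorial / 2 * opNorm G ^ (2 * p) * (n : ℝ) ^ (2 * p - 1) *
      ((8 * (2 * p + 1) : ℝ) * (Real.exp p * Real.exp p) * (2 * r) ^ p) := by ring
    _ ≤ (2 * p).factorial / 2 * opNorm G ^ (2 * p) * (n : ℝ) ^ (2 * p - 1) *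
      (1000 * r) ^ (2 * p - 1) := by gcongr
    _ = _ := by rw [show 1000 * (n : ℝ) * r = n * (1000 * r) by ring, mul_pow (n : ℝ)]; ring

lemma final_all (h : IsUniformOnSphere μ) (G : Matrix (Fin n) (Fin n) ℝ) (hG : G.IsHermitian)
    (r : ℕ) (hr : G.rank ≤ 2 * r) (x : EuclideanSpace ℝ (Fin n)) (p : ℕ)
    (hp : 1 ≤ p) :
    (n : ℝ) ^ (4 * p) * ∫ q, (inner ℝ q.1 (toEuclideanCLM (𝕜 := ℝ) G q.2)) ^ (2 * p) *
        (inner ℝ q.2 x) ^ 2 ∂(μ.prod μ) ≤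
      (((2 * p).factorial : ℝ) / 2) * opNorm G ^ (2 * p) * (1000 * n * r) ^ (2 * p - 1) *
        ‖x‖ ^ 2 := by
  rcases eq_or_ne x 0 with rfl | hx
  · simp
  have hx' : ‖x‖ ≠ 0 := norm_ne_zero_iff.2 hx
  have h1 := final_unit h G hG r hr (‖x‖⁻¹ • x) (by simp [norm_smul, hx']) p hp
  have h2 : ∀ q : EuclideanSpace ℝ (Fin n) × EuclideanSpace ℝ (Fin n),
      (inner ℝ q.1 (toEuclideanCLM (𝕜 := ℝ) G q.2)) ^ (2 * p) * (inner ℝ q.2 (‖x‖⁻¹ • x)) ^ 2 =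
      (‖x‖ ^ 2)⁻¹ * ((inner ℝ q.1 (toEuclideanCLM (𝕜 := ℝ) G q.2)) ^ (2 * p) *
        (inner ℝ q.2 x) ^ 2) := by
    intro q
    rw [inner_smul_right, mul_pow, inv_pow]; ring
  simp only [h2, integral_const_mul] at h1
  rw [mul_left_comm, inv_mul_le_iff₀ (by positivity)] at h1
  linarith

end SphereAux

/-- there is an absolute constant `C > 0` such that for `u, v` independent
uniform on `S^{n-1}`, any fixed symmetric `G` of rank at most `2r`, and
`B = n² u uᵀ G v vᵀ`, for every integer `p ≥ 1` one has
`E[(Bᵀ B)^p] ⪯ ((2p)!/2) ‖G‖^{2p} (C n r)^{2p-1} · I_n` in the Loewner order. -/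
theorem stmt_15 :
    ∃ C : ℝ, 0 < C ∧
      ∀ (n r : ℕ) (μ : Measure (EuclideanSpace ℝ (Fin n))),
        IsUniformOnSphere μ →
        ∀ G : Matrix (Fin n) (Fin n) ℝ, G.IsHermitian → G.rank ≤ 2 * r →
        ∀ p : ℕ, 1 ≤ p →
        Matrix.PosSemidef
          (((((2 * p).factorial : ℝ) / 2) * opNorm G ^ (2 * p) *
              (C * n * r) ^ (2 * p - 1)) • (1 : Matrix (Fin n) (Fin n) ℝ)
            - Matrix.of fun i j =>
                ∫ q, (((Bmat G q)ᵀ * Bmat G q) ^ p) i j ∂(μ.prod μ)) := by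
  refine ⟨1000, by norm_num, ?_⟩
  intro n r μ h G hG hr p hp
  have := h.1
  have hE : ∀ i j, ∫ q, (((Bmat G q)ᵀ * Bmat G q) ^ p) i j ∂(μ.prod μ) =
      ∫ q, (n : ℝ) ^ (4 * p) * (inner ℝ q.1 (toEuclideanCLM (𝕜 := ℝ) G q.2)) ^ (2 * p) *
        (q.2 i * q.2 j) ∂(μ.prod μ) := by
    intro i j
    refine integral_congr_ae ?_
    filter_upwards [SphereAux.ae_prod_norm h] with q hq
    exact SphereAux.Bpow G q hq.1 hq.2 p hp i j
  simp only [hE]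
  refine Matrix.PosSemidef.of_dotProduct_mulVec_nonneg ?_ ?_
  · ext i j
    simp only [conjTranspose_apply, star_trivial, Matrix.sub_apply, Matrix.smul_apply, of_apply]
    rw [Matrix.one_apply, Matrix.one_apply]
    simp only [eq_comm (a := i)]
    congr 1
    refine integral_congr_ae (.of_forall fun q => ?_)
    simp only
    ring
  · intro x
    have hfin := SphereAux.final_all h G hG r hr (WithLp.toLp 2 x) p hp
    have hx : ‖(WithLp.toLp 2 x : EuclideanSpace ℝ (Fin n))‖ ^ 2 = x ⬝ᵥ x := by
      rw [EuclideanSpace.norm_sq_eq]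
      simp [dotProduct, pow_two]
    have hq : x ⬝ᵥ (Matrix.of fun i j => ∫ q, (n : ℝ) ^ (4 * p) *
        (inner ℝ q.1 (toEuclideanCLM (𝕜 := ℝ) G q.2)) ^ (2 * p) *
        (q.2 i * q.2 j) ∂(μ.prod μ)) *ᵥ x = (n : ℝ) ^ (4 * p) *
          ∫ q, (inner ℝ q.1 (toEuclideanCLM (𝕜 := ℝ) G q.2)) ^ (2 * p) *
        (inner ℝ q.2 (WithLp.toLp 2 x)) ^ 2 ∂(μ.prod μ) := by
      simp only [dotProduct, mulVec, of_apply]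
      simp only [← integral_mul_const]
      have hi : ∀ i j : Fin n, Integrable (fun q : EuclideanSpace ℝ (Fin n) ×
          EuclideanSpace ℝ (Fin n) => (n : ℝ) ^ (4 * p) *
          (inner ℝ q.1 (toEuclideanCLM (𝕜 := ℝ) G q.2)) ^ (2 * p) *
          (q.2 i * q.2 j) * x j) (μ.prod μ) := fun i j =>
        SphereAux.integrable_cont_prod h (by fun_prop)
      have h1 : ∀ i, ∑ j, ∫ q : EuclideanSpace ℝ (Fin n) ×
          EuclideanSpace ℝ (Fin n), (n : ℝ) ^ (4 * p) *
          (inner ℝ q.1 (toEuclideanCLM (𝕜 := ℝ) G q.2)) ^ (2 * p) *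
          (q.2 i * q.2 j) * x j ∂(μ.prod μ) = _ := fun i =>
        (integral_finsetSum _ (fun j _ => hi i j)).symm
      simp only [h1, ← integral_const_mul]
      rw [← integral_finsetSum _ (fun i _ =>
        (integrable_finsetSum _ (fun j _ => hi i j)).const_mul _)]
      refine integral_congr_ae (.of_forall fun q => ?_)
      simp only
      have h2 : inner ℝ q.2 (WithLp.toLp 2 x) = ∑ i, x i * q.2 i := by
        rw [PiLp.inner_apply]
        simp
      rw [h2, pow_two, Finset.sum_mul_sum, ← mul_assoc, Finset.mul_sum]
      refine Finset.sum_congr rfl fun i _ => ?_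
      rw [Finset.mul_sum, Finset.mul_sum]
      refine Finset.sum_congr rfl fun j _ => ?_
      ring
    rw [star_trivial, Matrix.sub_mulVec, dotProduct_sub, hq, Matrix.smul_mulVec, Matrix.one_mulVec,
      dotProduct_smul, smul_eq_mul, ← hx]
    linarith
end

section
/- Let u, v be independent uniform on S^{n-1} and r ≤ n, p ≥ 2 an integer. Then E[(Σ_{i=1}^r u_i²)^{p-1} · (u_{:r} u_{:r}^T ⊗ v v^T) ] ⪯ (p!/2)·(6(r+2)/n)^{p-1}·(1/n^p)·I_{n²}·n^p, i.e., E[(n² u_{:r}u_{:r}^T ⊗ v v^T)^p] ⪯ (p!/2)(6n(r+2))^{p-1} I_{n²}. -/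
open MeasureTheory Matrix Kronecker

/-- `u_{:r}` : the vector `u` with all coordinates after the `r`-th zeroed out. -/
def truncLow {n : ℕ} (r : ℕ) (u : EuclideanSpace ℝ (Fin n)) : Fin n → ℝ :=
  fun i => if (i : ℕ) < r then u i else 0

/-- partial sum of squares -/
noncomputable def lowSq {n : ℕ} (r : ℕ) (u : EuclideanSpace ℝ (Fin n)) : ℝ :=
  ∑ k : Fin n, if (k : ℕ) < r then u k ^ 2 else 0

/-- plane rotation, as a function -/
noncomputable def rotFun {n : ℕ} (i j : Fin n) (θ : ℝ) (u : EuclideanSpace ℝ (Fin n)) :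
    EuclideanSpace ℝ (Fin n) :=
  WithLp.toLp 2 (fun k => if k = i then Real.cos θ * u i + Real.sin θ * u j
    else if k = j then -Real.sin θ * u i + Real.cos θ * u j else u k)

lemma rotFun_apply {n : ℕ} (i j : Fin n) (θ : ℝ) (u : EuclideanSpace ℝ (Fin n)) (k : Fin n) :
    rotFun i j θ u k = if k = i then Real.cos θ * u i + Real.sin θ * u j
    else if k = j then -Real.sin θ * u i + Real.cos θ * u j else u k := rfl

lemma rotFun_norm {n : ℕ} (i j : Fin n) (hij : i ≠ j) (θ : ℝ) (u : EuclideanSpace ℝ (Fin n)) :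
    ‖rotFun i j θ u‖ = ‖u‖ := by
  rw [EuclideanSpace.norm_eq, EuclideanSpace.norm_eq]
  congr 1
  simp only [Real.norm_eq_abs, sq_abs, rotFun_apply]
  have key : ∀ f : Fin n → ℝ, ∑ k, f k = f i + (f j + ∑ k ∈ (Finset.univ.erase i).erase j, f k) := by
    intro f
    rw [Finset.add_sum_erase _ _ (by simp [hij.symm]), Finset.add_sum_erase _ _ (by simp)]
  rw [key, key (fun k => u k ^ 2)]
  have : ∑ k ∈ (Finset.univ.erase i).erase j, (if k = i then Real.cos θ * u i + Real.sin θ * u j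
    else if k = j then -Real.sin θ * u i + Real.cos θ * u j else u k) ^ 2
      = ∑ k ∈ (Finset.univ.erase i).erase j, u k ^ 2 := by
    apply Finset.sum_congr rfl
    intro k hk
    simp only [Finset.mem_erase] at hk
    simp [hk.1, hk.2.1]
  rw [this]
  simp only [if_true, hij.symm, if_false]
  have := Real.sin_sq_add_cos_sq θ
  linear_combination (u i ^ 2 + u j ^ 2) * this

/-- plane rotation as a linear isometry -/
noncomputable def rotIso {n : ℕ} (i j : Fin n) (hij : i ≠ j) (θ : ℝ) :
    EuclideanSpace ℝ (Fin n) ≃ₗᵢ[ℝ] EuclideanSpace ℝ (Fin n) :=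
  LinearIsometry.toLinearIsometryEquiv
    { toFun := rotFun i j θ
      map_add' := by
        intro x y
        ext k
        simp only [rotFun_apply, PiLp.add_apply]
        split_ifs <;> ring
      map_smul' := by
        intro c x
        ext k
        simp only [rotFun_apply, PiLp.smul_apply, smul_eq_mul, RingHom.id_apply]
        split_ifs <;> ring
      norm_map' := rotFun_norm i j hij θ } rfl

lemma rotIso_apply {n : ℕ} (i j : Fin n) (hij : i ≠ j) (θ : ℝ) (u : EuclideanSpace ℝ (Fin n)) :
    rotIso i j hij θ u = rotFun i j θ u := rfl

lemma rot_hasDerivAt {n : ℕ} (i j : Fin n) (hij : i ≠ j) (θ : ℝ)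
    (u : EuclideanSpace ℝ (Fin n)) (k : Fin n) :
    HasDerivAt (fun t => rotFun i j t u k)
      (if k = i then rotFun i j θ u j else if k = j then - rotFun i j θ u i else 0) θ := by
  simp only [rotFun_apply, if_true, hij.symm, if_false]
  split_ifs
  · exact ((Real.hasDerivAt_cos θ).mul_const _).add ((Real.hasDerivAt_sin θ).mul_const _)
  · refine ((((Real.hasDerivAt_sin θ).neg).mul_const (u i)).add
      ((Real.hasDerivAt_cos θ).mul_const (u j))).congr_deriv ?_
    ring
  · exact hasDerivAt_const _ _

lemma ae_norm {n : ℕ} {μ : Measure (EuclideanSpace ℝ (Fin n))} (hμ : IsUniformOnSphere μ) :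
    ∀ᵐ u ∂μ, ‖u‖ = 1 := by
  have := hμ.1
  have h := (prob_compl_eq_zero_iff (μ := μ) (Metric.isClosed_sphere.measurableSet)).2 hμ.2.1
  rw [ae_iff]
  convert h using 2
  ext u
  simp

lemma cont_bound {n : ℕ} (F : EuclideanSpace ℝ (Fin n) → ℝ) (hF : Continuous F) :
    ∃ C, ∀ u, ‖u‖ = 1 → ‖F u‖ ≤ C := by
  obtain ⟨C, hC⟩ := (isCompact_sphere (0 : EuclideanSpace ℝ (Fin n)) 1).exists_bound_of_continuousOn
    hF.continuousOn
  exact ⟨C, fun u hu => hC u (by simpa using hu)⟩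

lemma cont_int {n : ℕ} {μ : Measure (EuclideanSpace ℝ (Fin n))} (hμ : IsUniformOnSphere μ)
    (F : EuclideanSpace ℝ (Fin n) → ℝ) (hF : Continuous F) : Integrable F μ := by
  have := hμ.1
  obtain ⟨C, hC⟩ := cont_bound F hF
  exact Integrable.of_bound hF.aestronglyMeasurable C ((ae_norm hμ).mono hC)

lemma integral_rot {n : ℕ} {μ : Measure (EuclideanSpace ℝ (Fin n))} (hμ : IsUniformOnSphere μ)
    (i j : Fin n) (hij : i ≠ j) (F F' : EuclideanSpace ℝ (Fin n) → ℝ) (hF : Continuous F)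
    (hF' : Continuous F')
    (h : ∀ u θ, HasDerivAt (fun t => F (rotFun i j t u)) (F' (rotFun i j θ u)) θ) :
    ∫ u, F' u ∂μ = 0 := by
  have := hμ.1
  obtain ⟨C, hC⟩ := cont_bound F' hF'
  have hc : ∀ θ, Continuous (rotFun i j θ) := fun θ => (rotIso i j hij θ).continuous
  have hinv : ∀ θ, ∀ G : EuclideanSpace ℝ (Fin n) → ℝ, Continuous G →
      ∫ u, G (rotFun i j θ u) ∂μ = ∫ u, G u ∂μ := by
    intro θ G hG
    conv_rhs => rw [← hμ.2.2 (rotIso i j hij θ)]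
    rw [integral_map (rotIso i j hij θ).continuous.aemeasurable hG.aestronglyMeasurable]
    rfl
  have D := (hasDerivAt_integral_of_dominated_loc_of_deriv_le (μ := μ) (x₀ := (0:ℝ))
    (s := Set.univ) (F := fun t u => F (rotFun i j t u)) (F' := fun t u => F' (rotFun i j t u))
    (bound := fun _ => C) Filter.univ_mem
    (Filter.Eventually.of_forall fun t => (hF.comp (hc t)).aestronglyMeasurable)
    (cont_int hμ _ (hF.comp (hc 0))) (hF'.comp (hc 0)).aestronglyMeasurable
    ((ae_norm hμ).mono fun u hu t _ => hC _ (by rw [rotFun_norm i j hij, hu]))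
    (integrable_const C) (Filter.Eventually.of_forall fun u t _ => h u t)).2
  simp only [hinv _ F hF, hinv _ F' hF'] at D
  exact D.unique (hasDerivAt_const _ _)

lemma lowSq_cont {n : ℕ} (r : ℕ) : Continuous (lowSq (n := n) r) := by
  unfold lowSq
  refine continuous_finsetSum _ fun k _ => ?_
  split_ifs <;> fun_prop

lemma lowSq_deriv {n : ℕ} (r : ℕ) (i j : Fin n) (hij : i ≠ j) (θ : ℝ)
    (u : EuclideanSpace ℝ (Fin n)) :
    HasDerivAt (fun t => lowSq r (rotFun i j t u))
      ((if (i : ℕ) < r then 2 * rotFun i j θ u i * rotFun i j θ u j else 0)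
        - (if (j : ℕ) < r then 2 * rotFun i j θ u i * rotFun i j θ u j else 0)) θ := by
  unfold lowSq
  have h : ∀ k ∈ (Finset.univ : Finset (Fin n)),
      HasDerivAt (fun t => if (k : ℕ) < r then rotFun i j t u k ^ 2 else 0)
      ((if k = i then (if (i : ℕ) < r then 2 * rotFun i j θ u i * rotFun i j θ u j else 0) else 0)
        - (if k = j then (if (j : ℕ) < r then 2 * rotFun i j θ u i * rotFun i j θ u j else 0)
            else 0)) θ := by
    intro k _
    have hk := (rot_hasDerivAt i j hij θ u k).pow 2
    by_cases hkr : (k : ℕ) < r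
    · simp only [hkr, if_true]
      refine hk.congr_deriv ?_
      by_cases h1 : k = i
      · subst h1; simp [hkr, hij]
      · by_cases h2 : k = j
        · subst h2; simp [hkr, h1]; ring
        · simp [h1, h2]
    · simp only [hkr, if_false]
      refine (hasDerivAt_const θ (0:ℝ)).congr_deriv ?_
      by_cases h1 : k = i
      · subst h1; simp [hkr, hij]
      · by_cases h2 : k = j
        · subst h2; simp [hkr, h1]
        · simp [h1, h2]
  refine (HasDerivAt.fun_sum h).congr_deriv ?_
  simp [Finset.sum_sub_distrib]

lemma offdiag {n : ℕ} {μ : Measure (EuclideanSpace ℝ (Fin n))} (hμ : IsUniformOnSphere μ)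
    (r m : ℕ) (i j : Fin n) (hij : i ≠ j) (hi : (i : ℕ) < r) (hj : (j : ℕ) < r) :
    ∫ u, lowSq r u ^ m * (u i * u j) ∂μ = 0 := by
  have hs := lowSq_cont (n := n) r
  have := integral_rot hμ i j hij (fun u => lowSq r u ^ m * (u i ^ 2))
    (fun u => 2 * (lowSq r u ^ m * (u i * u j))) (by fun_prop) (by fun_prop) (by
      intro u θ
      have h1 := (lowSq_deriv r i j hij θ u).pow m
      have h2 := (rot_hasDerivAt i j hij θ u i).pow 2
      refine (h1.mul h2).congr_deriv ?_
      simp [hi, hj]; ring)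
  rw [integral_const_mul] at this
  linarith

lemma diag_eq {n : ℕ} {μ : Measure (EuclideanSpace ℝ (Fin n))} (hμ : IsUniformOnSphere μ)
    (r m : ℕ) (i j : Fin n) (hi : (i : ℕ) < r) (hj : (j : ℕ) < r) :
    ∫ u, lowSq r u ^ m * (u i * u i) ∂μ = ∫ u, lowSq r u ^ m * (u j * u j) ∂μ := by
  by_cases hij : i = j
  · rw [hij]
  have hs := lowSq_cont (n := n) r
  have := integral_rot hμ i j hij (fun u => lowSq r u ^ m * (u i * u j))
    (fun u => lowSq r u ^ m * (u j * u j) - lowSq r u ^ m * (u i * u i)) (by fun_prop)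
    (by fun_prop) (by
      intro u θ
      have h1 := (lowSq_deriv r i j hij θ u).pow m
      have h2 := (rot_hasDerivAt i j hij θ u i).mul (rot_hasDerivAt i j hij θ u j)
      refine (h1.mul h2).congr_deriv ?_
      simp [hi, hj, Ne.symm hij]; ring)
  rw [integral_sub (cont_int hμ _ (by fun_prop)) (cont_int hμ _ (by fun_prop))] at this
  linarith

lemma card_low {n r : ℕ} (hr : r ≤ n) :
    (Finset.univ.filter (fun k : Fin n => (k : ℕ) < r)).card = r := by
  rw [Fin.card_filter_val_lt]; omega

lemma diag_val {n : ℕ} {μ : Measure (EuclideanSpace ℝ (Fin n))} (hμ : IsUniformOnSphere μ)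
    (r m : ℕ) (hr : r ≤ n) (i : Fin n) (hi : (i : ℕ) < r) :
    (r : ℝ) * ∫ u, lowSq r u ^ m * (u i * u i) ∂μ = ∫ u, lowSq r u ^ (m + 1) ∂μ := by
  have hs := lowSq_cont (n := n) r
  have h1 : ∀ u : EuclideanSpace ℝ (Fin n), lowSq r u ^ (m + 1) =
      ∑ k ∈ Finset.univ.filter (fun k : Fin n => (k : ℕ) < r), lowSq r u ^ m * (u k * u k) := by
    intro u
    rw [← Finset.mul_sum, Finset.sum_filter, pow_succ]
    simp only [← pow_two]
    rfl
  simp_rw [h1]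
  rw [integral_finsetSum _ (fun k _ => cont_int hμ _ (by fun_prop))]
  rw [Finset.sum_congr rfl (fun k hk => diag_eq hμ r m k i (Finset.mem_filter.1 hk).2 hi)]
  rw [Finset.sum_const, card_low hr, nsmul_eq_mul]

lemma moment_rec {n : ℕ} {μ : Measure (EuclideanSpace ℝ (Fin n))} (hμ : IsUniformOnSphere μ)
    (r m : ℕ) (hr : r ≤ n) :
    ((n : ℝ) + 2 * m) * ∫ u, lowSq r u ^ (m + 1) ∂μ
      = ((r : ℝ) + 2 * m) * ∫ u, lowSq r u ^ m ∂μ := by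
  have := hμ.1
  have hs := lowSq_cont (n := n) r
  set A := Finset.univ.filter (fun k : Fin n => (k : ℕ) < r) with hA
  set B := Finset.univ.filter (fun k : Fin n => ¬ (k : ℕ) < r) with hB
  have hAB : A.card + B.card = n := by
    rw [Finset.card_filter_add_card_filter_not]; simp
  have hAc : A.card = r := card_low hr
  have hBc : (B.card : ℝ) = n - r := by
    have : (A.card : ℝ) + B.card = n := by exact_mod_cast hAB
    rw [hAc] at this; linarith
  let G : Fin n → Fin n → EuclideanSpace ℝ (Fin n) → ℝ := fun i j u =>
    lowSq r u ^ m * (u j ^ 2 - u i ^ 2) + 2 * (m * lowSq r u ^ (m - 1)) * (u i ^ 2 * u j ^ 2)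
  have hGc : ∀ i j, Continuous (G i j) := fun i j => by fun_prop
  have hG : ∀ i ∈ A, ∀ j ∈ B, ∫ u, G i j u ∂μ = 0 := by
    intro i hi j hj
    have hi := (Finset.mem_filter.1 hi).2
    have hj := (Finset.mem_filter.1 hj).2
    have hij : i ≠ j := by rintro rfl; exact hj hi
    refine integral_rot hμ i j hij (fun u => lowSq r u ^ m * (u i * u j)) _ (by fun_prop)
      (hGc i j) ?_
    intro u θ
    have h1 := (lowSq_deriv r i j hij θ u).pow m
    have h2 := (rot_hasDerivAt i j hij θ u i).mul (rot_hasDerivAt i j hij θ u j)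
    refine (h1.mul h2).congr_deriv ?_
    simp [hi, hj, Ne.symm hij, G]; ring
  have h0 : ∫ u, ∑ i ∈ A, ∑ j ∈ B, G i j u ∂μ = 0 := by
    rw [integral_finsetSum _ (fun i _ => cont_int hμ _
      (continuous_finsetSum _ fun j _ => hGc i j))]
    refine Finset.sum_eq_zero fun i hi => ?_
    rw [integral_finsetSum _ (fun j _ => cont_int hμ _ (hGc i j))]
    exact Finset.sum_eq_zero fun j hj => hG i hi j hj
  have hae : ∀ᵐ u ∂μ, ∑ i ∈ A, ∑ j ∈ B, G i j u =
      ((r : ℝ) + 2 * m) * lowSq r u ^ m - ((n : ℝ) + 2 * m) * lowSq r u ^ (m + 1) := by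
    filter_upwards [ae_norm hμ] with u hu
    have e1 : ∑ i ∈ A, u i ^ 2 = lowSq r u := by
      rw [hA, Finset.sum_filter]; rfl
    have e2 : ∑ j ∈ B, u j ^ 2 = 1 - lowSq r u := by
      have : ∑ i ∈ A, u i ^ 2 + ∑ j ∈ B, u j ^ 2 = 1 := by
        rw [Finset.sum_filter_add_sum_filter_not, ← EuclideanSpace.real_norm_sq_eq, hu, one_pow]
      linarith
    have e3 : ∑ i ∈ A, ∑ j ∈ B, G i j u = lowSq r u ^ m * (A.card * (∑ j ∈ B, u j ^ 2)
        - B.card * ∑ i ∈ A, u i ^ 2) + 2 * (m * lowSq r u ^ (m - 1)) *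
          ((∑ i ∈ A, u i ^ 2) * ∑ j ∈ B, u j ^ 2) := by
      simp only [G, Finset.sum_add_distrib, ← Finset.mul_sum, Finset.sum_sub_distrib,
        Finset.sum_const, nsmul_eq_mul, ← Finset.sum_mul]
    rw [e3, e1, e2, hAc, hBc]
    rcases m with _ | m
    · simp; ring
    · simp; ring
  rw [integral_congr_ae hae, integral_sub (cont_int hμ _ (by fun_prop))
    (cont_int hμ _ (by fun_prop)), integral_const_mul, integral_const_mul] at h0
  linarith

lemma lowSq_nonneg {n : ℕ} (r : ℕ) (u : EuclideanSpace ℝ (Fin n)) : 0 ≤ lowSq r u := by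
  unfold lowSq
  refine Finset.sum_nonneg fun k _ => ?_
  split_ifs <;> positivity

/-- moment bound -/
lemma moment_bound {n : ℕ} {μ : Measure (EuclideanSpace ℝ (Fin n))} (hμ : IsUniformOnSphere μ)
    (r m : ℕ) (hr : r ≤ n) (hn : 0 < n) :
    (n : ℝ) ^ (m + 1) * ∫ u, lowSq r u ^ (m + 1) ∂μ ≤ r * (m.factorial * ((r : ℝ) + 2) ^ m) := by
  have := hμ.1
  have hn' : (0:ℝ) < n := by exact_mod_cast hn
  have hr0 : (0:ℝ) ≤ r := by positivity
  induction m with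
  | zero =>
    have := moment_rec hμ r 0 hr
    simp at this
    simp [this]
  | succ m ih =>
    have h := moment_rec hμ r (m + 1) hr
    set a := ∫ u, lowSq r u ^ (m + 1) ∂μ
    set b := ∫ u, lowSq r u ^ (m + 1 + 1) ∂μ
    have hb : 0 ≤ b := integral_nonneg fun u => pow_nonneg (lowSq_nonneg r u) _
    have ha : 0 ≤ a := integral_nonneg fun u => pow_nonneg (lowSq_nonneg r u) _
    push_cast at h
    have hm : (0:ℝ) ≤ m := by positivity
    have h1 : (n:ℝ) * b ≤ ((m:ℝ) + 1) * (r + 2) * a := by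
      have : (r + 2 * ((m:ℝ) + 1)) * a ≤ ((m:ℝ) + 1) * (r + 2) * a := by
        gcongr
        nlinarith [mul_nonneg hm hr0]
      nlinarith [mul_nonneg hm hb]
    calc (n:ℝ) ^ (m + 1 + 1) * b = (n:ℝ) ^ (m + 1) * (n * b) := by ring
      _ ≤ (n:ℝ) ^ (m + 1) * (((m:ℝ) + 1) * (r + 2) * a) := by gcongr
      _ = (((m:ℝ) + 1) * (r + 2)) * ((n:ℝ) ^ (m + 1) * a) := by ring
      _ ≤ (((m:ℝ) + 1) * (r + 2)) * (r * (m.factorial * ((r : ℝ) + 2) ^ m)) := by gcongr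
      _ = _ := by rw [Nat.factorial_succ]; push_cast; ring

lemma mat_pow {ι : Type*} [Fintype ι] [DecidableEq ι] (M : Matrix ι ι ℝ) (a : ℝ)
    (h : M * M = a • M) (m : ℕ) : M ^ (m + 1) = a ^ m • M := by
  induction m with
  | zero => simp
  | succ m ih => rw [pow_succ, ih, smul_mul_assoc, h, smul_smul, pow_succ]

lemma lowSq_trunc {n : ℕ} (r : ℕ) (u : EuclideanSpace ℝ (Fin n)) :
    truncLow r u ⬝ᵥ truncLow r u = lowSq r u := by
  unfold truncLow lowSq dotProduct
  refine Finset.sum_congr rfl fun k _ => ?_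
  by_cases hk : (k : ℕ) < r
  · simp only [hk, if_true, pow_two]
  · simp only [hk, if_false, mul_zero]

lemma lowSq_full {n : ℕ} (u : EuclideanSpace ℝ (Fin n)) :
    (fun a => u a) ⬝ᵥ (fun a => u a) = lowSq n u := by
  unfold lowSq dotProduct
  refine Finset.sum_congr rfl fun k _ => ?_
  simp [k.2]; ring

lemma entry {n : ℕ} (r m : ℕ) (u v : EuclideanSpace ℝ (Fin n)) (i j : Fin n × Fin n) :
    ((((n : ℝ) ^ 2 • (Matrix.vecMulVec (truncLow r u) (truncLow r u) ⊗ₖ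
                Matrix.vecMulVec (fun a => v a) (fun a => v a))) ^ (m + 1) :
              Matrix (Fin n × Fin n) (Fin n × Fin n) ℝ)) i j
      = ((n : ℝ) ^ 2) ^ (m + 1) * ((lowSq r u ^ m * (truncLow r u i.1 * truncLow r u j.1)) *
        (lowSq n v ^ m * (v i.2 * v j.2))) := by
  rw [smul_pow, mat_pow _ (lowSq r u * lowSq n v)]
  · simp only [Matrix.smul_apply, smul_eq_mul, Matrix.vecMulVec_apply,
      Matrix.kroneckerMap_apply]
    ring
  · rw [← Matrix.mul_kronecker_mul, Matrix.vecMulVec_mul_vecMulVec,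
      Matrix.vecMulVec_mul_vecMulVec, lowSq_trunc, lowSq_full]
    ext a b
    simp [Matrix.vecMulVec_apply, Matrix.kroneckerMap_apply]
    ring

/-- for `u, v` independent uniform on `S^{n-1}`, `r ≤ n`, and any integer
`p ≥ 2`, `E[(n² u_{:r} u_{:r}ᵀ ⊗ v vᵀ)^p] ⪯ (p!/2)(6n(r+2))^{p-1} · I_{n²}` in the
Loewner order. -/
theorem stmt_19 {n r : ℕ} (hr : r ≤ n) (μ : Measure (EuclideanSpace ℝ (Fin n)))
    (hμ : IsUniformOnSphere μ) (p : ℕ) (hp : 2 ≤ p) :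
    Matrix.PosSemidef
      (((((p.factorial : ℝ)) / 2) * (6 * (n : ℝ) * ((r : ℝ) + 2)) ^ (p - 1)) •
          (1 : Matrix (Fin n × Fin n) (Fin n × Fin n) ℝ)
        - Matrix.of fun i j => ∫ q,
            ((((n : ℝ) ^ 2 • (Matrix.vecMulVec (truncLow r q.1) (truncLow r q.1) ⊗ₖ
                Matrix.vecMulVec (fun a => q.2 a) (fun a => q.2 a))) ^ p :
              Matrix (Fin n × Fin n) (Fin n × Fin n) ℝ)) i j ∂(μ.prod μ)) := by
  rcases Nat.eq_zero_or_pos n with hn | hn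
  · subst hn
    convert Matrix.PosSemidef.zero
    ext i
    exact i.1.elim0
  obtain ⟨m, rfl⟩ : ∃ m, p = m + 1 := ⟨p - 1, by omega⟩
  have := hμ.1
  have hn' : (0:ℝ) < n := by exact_mod_cast hn
  simp only [entry, integral_const_mul, Nat.add_sub_cancel]
  have hprod : ∀ i j : Fin n × Fin n, ∫ q : EuclideanSpace ℝ (Fin n) × EuclideanSpace ℝ (Fin n),
      (lowSq r q.1 ^ m * (truncLow r q.1 i.1 * truncLow r q.1 j.1)) *
        (lowSq n q.2 ^ m * (q.2 i.2 * q.2 j.2)) ∂(μ.prod μ)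
      = (∫ u, lowSq r u ^ m * (truncLow r u i.1 * truncLow r u j.1) ∂μ) *
        ∫ v, lowSq n v ^ m * (v i.2 * v j.2) ∂μ := fun i j =>
    integral_prod_mul (fun u => lowSq r u ^ m * (truncLow r u i.1 * truncLow r u j.1))
      (fun v : EuclideanSpace ℝ (Fin n) => lowSq n v ^ m * (v i.2 * v j.2))
  simp only [hprod]
  have hfull : ∫ v, lowSq n v ^ (m + 1) ∂μ = 1 := by
    have : ∀ᵐ v ∂μ, lowSq n v ^ (m + 1) = 1 := by
      filter_upwards [ae_norm hμ] with v hv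
      have : lowSq n v = 1 := by
        rw [← one_pow 2, ← hv, EuclideanSpace.real_norm_sq_eq]
        unfold lowSq
        simp
      rw [this, one_pow]
    rw [integral_congr_ae this]; simp
  have hV : ∀ a b : Fin n, ∫ v, lowSq n v ^ m * (v a * v b) ∂μ = if a = b then 1 / (n:ℝ) else 0 := by
    intro a b
    split_ifs with hab
    · subst hab
      have := diag_val hμ n m le_rfl a a.2
      rw [hfull] at this
      rw [eq_div_iff hn'.ne']
      linarith
    · exact offdiag hμ n m a b hab a.2 b.2
  set J := ∫ u, lowSq r u ^ (m + 1) ∂μ with hJ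
  have hU : ∀ a b : Fin n, ∫ u, lowSq r u ^ m * (truncLow r u a * truncLow r u b) ∂μ
      = if a = b then (if (a : ℕ) < r then J / r else 0) else 0 := by
    intro a b
    unfold truncLow
    by_cases ha : (a : ℕ) < r
    · by_cases hb : (b : ℕ) < r
      · simp only [ha, hb, if_true]
        split_ifs with hab
        · subst hab
          have := diag_val hμ r m hr a ha
          have hr' : (r : ℝ) ≠ 0 := by
            have : 0 < r := by omega
            positivity
          rw [hJ, ← this]; field_simp
        · exact offdiag hμ r m a b hab ha hb
      · have : a ≠ b := by rintro rfl; exact hb ha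
        simp [hb, this]
    · simp [ha]
  simp only [hU, hV]
  set c : ℝ := (((m + 1).factorial : ℝ)) / 2 * (6 * (n : ℝ) * ((r : ℝ) + 2)) ^ m with hc
  have hc0 : 0 ≤ c := by positivity
  have hdiag : (c • (1 : Matrix (Fin n × Fin n) (Fin n × Fin n) ℝ)
      - Matrix.of fun i j : Fin n × Fin n => ((n:ℝ) ^ 2) ^ (m + 1) *
        ((if i.1 = j.1 then (if (i.1 : ℕ) < r then J / r else 0) else 0) *
          if i.2 = j.2 then 1 / (n:ℝ) else 0))
      = Matrix.diagonal fun i : Fin n × Fin n => c - ((n:ℝ) ^ 2) ^ (m + 1) *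
        ((if (i.1 : ℕ) < r then J / r else 0) * (1 / (n:ℝ))) := by
    ext i j
    by_cases hij : i = j
    · subst hij; simp
    · have : i.1 = j.1 → i.2 ≠ j.2 := fun h1 h2 => hij (Prod.ext h1 h2)
      by_cases h1 : i.1 = j.1
      · simp [hij, this h1]
      · simp [hij, h1]
  rw [hdiag]
  refine Matrix.PosSemidef.diagonal ?_
  intro i
  simp only [Pi.zero_apply, sub_nonneg]
  split_ifs with hi
  · have hr0 : (0:ℝ) < r := by
      have : 0 < r := by omega
      exact_mod_cast this
    have hb := moment_bound hμ r m hr hn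
    rw [← hJ] at hb
    have hb' : (n:ℝ) ^ (m + 1) * (J / r) ≤ m.factorial * ((r : ℝ) + 2) ^ m := by
      rw [← mul_div_assoc, div_le_iff₀ hr0]; linarith
    have h6 : (1:ℝ) ≤ 6 ^ m := one_le_pow₀ (by norm_num)
    have hm1 : (2:ℝ) ≤ (m:ℝ) + 1 := by
      have : 2 ≤ m + 1 := hp
      exact_mod_cast this
    calc ((n:ℝ) ^ 2) ^ (m + 1) * (J / r * (1 / (n:ℝ)))
        = (n:ℝ) ^ m * ((n:ℝ) ^ (m + 1) * (J / r)) := by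
          have : (1:ℝ) / n * n = 1 := by field_simp
          rw [← pow_mul, show 2 * (m + 1) = m + (m + 1) + 1 by ring, pow_add, pow_add, pow_one]
          linear_combination ((n:ℝ) ^ m * n ^ (m + 1) * (J / r)) * this
      _ ≤ (n:ℝ) ^ m * (m.factorial * ((r : ℝ) + 2) ^ m) := by gcongr
      _ = (2 / 2 * m.factorial) * (1 * ((n:ℝ) ^ m * ((r : ℝ) + 2) ^ m)) := by ring
      _ ≤ (((m:ℝ) + 1) / 2 * m.factorial) * (6 ^ m * ((n:ℝ) ^ m * ((r : ℝ) + 2) ^ m)) := by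
          gcongr
      _ = c := by
          rw [hc, Nat.factorial_succ, mul_pow, mul_pow]; push_cast; ring
  · simpa using hc0
end
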